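/- Let N be an even positive integer, M an odd positive integer with 2M ≤ N, let N_a be a positive integer with N ≤ N_a, and let U > 0. Then the Lieb–Wu equations admit a real solution (k_1,…,k_N, Λ_1,…,Λ_M) with −π ≤ k_1 < ⋯ < k_N ≤ π and Λ_1 < ⋯ < Λ_M which in addition is symmetric: k_j = −k_{N+1−j} for all j = 1,…,N and Λ_α = −Λ_{M+1−α} for all α = 1,…,M (in particular Λ_{(M+1)/2} = 0). -/

import Mathlib

open Real

/-- The phase function `θ_U(x) = -2 arctan(2x/U)` of the Lieb–Wu equations. -/
noncomputable def theta (U x : ℝ) : ℝ := -2 * Real.arctan (2 * x / U)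

/-- `det (1 + A)` is an affine combination, with universal weights, of the values
`det (1 + v i • A)`, by Lagrange interpolation of the polynomial `det (1 + t • A)` in `t`. -/
theorem exists_det_one_add_eq_sum (E : Type*) [NormedAddCommGroup E] [NormedSpace ℝ E]
    [FiniteDimensional ℝ E] (v : ℕ → ℝ) (hv : Function.Injective v) :
    ∃ (s : Finset ℕ) (c : ℕ → ℝ), ∑ i ∈ s, c i = 1 ∧ ∀ A : E →L[ℝ] E,
      (1 + A).det = ∑ i ∈ s, c i * (1 + v i • A).det := by
  classical
  let b := Module.finBasis ℝ E
  let s := Finset.range (Module.finrank ℝ E + 1)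
  have hvs : Set.InjOn v s := hv.injOn
  refine ⟨s, fun i => (Lagrange.basis s v i).eval 1, ?_, fun A => ?_⟩
  · rw [← Polynomial.eval_finsetSum, Lagrange.sum_basis hvs (by simp [s]), Polynomial.eval_one]
  · let B := LinearMap.toMatrix b b (A : E →ₗ[ℝ] E)
    let P : Polynomial ℝ := Matrix.det
      ((Polynomial.X : Polynomial ℝ) • B.map Polynomial.C
        + (1 : Matrix _ _ ℝ).map Polynomial.C)
    have hP : ∀ t : ℝ, (1 + t • A).det = P.eval t := by
      intro t
      rw [ContinuousLinearMap.det, ← LinearMap.det_toMatrix b, ← Polynomial.coe_evalRingHom,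
        RingHom.map_det]
      congr 1
      ext i j
      simp [B, LinearMap.toMatrix_apply, Matrix.one_apply, Finsupp.single_apply]
      simp [eq_comm, add_comm]
      split_ifs <;> simp [mul_comm]
    have hdeg : P.degree < s.card := by
      refine lt_of_le_of_lt Polynomial.degree_le_natDegree ?_
      have := Polynomial.natDegree_det_X_add_C_le B 1
      simp only [Fintype.card_fin] at this
      simp only [s, Finset.card_range]
      exact_mod_cast Nat.lt_succ_of_le this
    have h1 : (1 + A).det = P.eval 1 := by rw [← hP 1, one_smul]
    rw [h1, Lagrange.eq_interpolate hvs hdeg, Lagrange.interpolate_apply,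
      Polynomial.eval_finsetSum]
    refine Finset.sum_congr rfl fun i _ => ?_
    rw [Polynomial.eval_mul, Polynomial.eval_C, hP, mul_comm]

theorem det_one_add_smul_pos {E : Type*} [NormedAddCommGroup E] [NormedSpace ℝ E]
    [FiniteDimensional ℝ E] (A : E →L[ℝ] E) {t : ℝ} (ht : 0 ≤ t) (h : t * ‖A‖ < 1) :
    0 < (1 + t • A).det := by
  by_contra! hneg
  have hcont : Continuous fun s : ℝ => (1 + s • A).det :=
    ContinuousLinearMap.continuous_det.comp (by fun_prop)
  obtain ⟨s, hs, hs0⟩ := intermediate_value_Icc' ht hcont.continuousOn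
    (show (0 : ℝ) ∈ _ from ⟨hneg, by simp [ContinuousLinearMap.det]⟩)
  obtain ⟨w, hw, hw0⟩ := (Submodule.ne_bot_iff _).1
    (LinearMap.bot_lt_ker_of_det_eq_zero (f := ((1 + s • A : E →L[ℝ] E) : E →ₗ[ℝ] E)) hs0).ne'
  have hw' : w = -(s • A w) := by
    have : w + s • A w = 0 := by simpa using hw
    exact eq_neg_of_add_eq_zero_left this
  have hpos : 0 < ‖w‖ := norm_pos_iff.2 hw0
  have h1 : ‖w‖ ≤ s * (‖A‖ * ‖w‖) := by
    calc ‖w‖ = s * ‖A w‖ := by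
          conv_lhs => rw [hw', norm_neg, norm_smul, Real.norm_of_nonneg hs.1]
      _ ≤ _ := mul_le_mul_of_nonneg_left (A.le_opNorm w) hs.1
  have h2 : s * ‖A‖ ≤ t * ‖A‖ := mul_le_mul_of_nonneg_right hs.2 (norm_nonneg _)
  nlinarith

theorem lipschitzWith_indicator_closedBall {E F : Type*} [NormedAddCommGroup E]
    [NormedSpace ℝ E] [NormedAddCommGroup F] {u : E → F} {r : ℝ} {C : NNReal}
    (hu : LipschitzOnWith C u (Metric.closedBall 0 r)) (h0 : ∀ x, ‖x‖ = r → u x = 0) :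
    LipschitzWith C ((Metric.closedBall (0 : E) r).indicator u) := by
  have key : ∀ x y : E, ‖x‖ ≤ r → r < ‖y‖ → ‖u x‖ ≤ C * dist x y := by
    intro x y hx hy
    obtain ⟨z, hz, hzr⟩ := (convex_segment (𝕜 := ℝ) x y).isPreconnected.intermediate_value
      (left_mem_segment ℝ x y) (right_mem_segment ℝ x y) continuous_norm.continuousOn
      (show r ∈ Set.Icc ‖x‖ ‖y‖ from ⟨hx, hy.le⟩)
    have h1 := hu.dist_le_mul x (by simpa using hx) z (by simp [hzr])
    rw [h0 z hzr, dist_zero_right] at h1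
    refine h1.trans (mul_le_mul_of_nonneg_left ?_ C.2)
    have := dist_add_dist_of_mem_segment hz
    linarith [dist_nonneg (x := z) (y := y)]
  refine LipschitzWith.of_dist_le_mul fun x y => ?_
  by_cases hx : ‖x‖ ≤ r <;> by_cases hy : ‖y‖ ≤ r
  · simpa [Set.indicator, hx, hy] using hu.dist_le_mul x (by simpa using hx) y (by simpa using hy)
  · simpa [Set.indicator, hx, hy] using key x y hx (not_le.1 hy)
  · simpa [Set.indicator, hx, hy, dist_comm] using key y x hy (not_le.1 hx)
  · simp only [Set.indicator, mem_closedBall_zero_iff, hx, hy, if_false, dist_self]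
    positivity

theorem bijective_add_smul_of_lipschitzWith {E : Type*} [NormedAddCommGroup E]
    [NormedSpace ℝ E] [CompleteSpace E] {u : E → E} {C : NNReal} (hu : LipschitzWith C u)
    {t : ℝ} (ht : 0 ≤ t) (h : t * C < 1) : Function.Bijective fun x => x + t • u x := by
  have hlip : ∀ x y, dist (t • u x) (t • u y) ≤ t * C * dist x y := by
    intro x y
    rw [dist_smul₀, Real.norm_of_nonneg ht, mul_assoc]
    exact mul_le_mul_of_nonneg_left (hu.dist_le_mul x y) ht
  constructor
  · intro x y hxy
    have h1 : dist x y = dist (t • u x) (t • u y) := by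
      have h2 : x - y = -(t • u x - t • u y) := by
        have h3 : x + t • u x = y + t • u y := hxy
        rw [neg_sub, sub_eq_sub_iff_add_eq_add, h3, add_comm]
      rw [dist_eq_norm, dist_eq_norm, h2, norm_neg]
    have h2 := hlip x y
    rw [← dist_le_zero]
    nlinarith [dist_nonneg (x := x) (y := y)]
  · intro y
    have hc : ContractingWith (Real.toNNReal (t * C)) fun x => y - t • u x := by
      refine ⟨by simpa using h, LipschitzWith.of_dist_le_mul fun x z => ?_⟩
      rw [dist_sub_left, Real.coe_toNNReal _ (by positivity)]
      exact hlip x z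
    refine ⟨hc.fixedPoint, ?_⟩
    have := hc.fixedPoint_isFixedPt
    exact eq_sub_iff_add_eq.1 this.symm

/-- There is no `C¹` map to the unit sphere that fixes the unit sphere pointwise. -/
theorem not_exists_contDiff_retraction_sphere {E : Type*} [NormedAddCommGroup E]
    [InnerProductSpace ℝ E] [FiniteDimensional ℝ E] {h : E → E} (hh : ContDiff ℝ 1 h)
    (hnorm : ∀ x, ‖h x‖ = 1) (hsphere : ∀ x, ‖x‖ = 1 → h x = x) : False := by
  borelize E
  let μ : MeasureTheory.Measure E := MeasureTheory.volume
  let B : Set E := Metric.closedBall 0 1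
  have hBc : IsCompact B := isCompact_closedBall 0 1
  let u : E → E := fun x => h x - x
  have hu : ContDiff ℝ 1 u := hh.sub contDiff_id
  have hdu : Continuous (fderiv ℝ u) := hu.continuous_fderiv one_ne_zero
  obtain ⟨C₀, hC₀⟩ := hBc.exists_bound_of_continuousOn hdu.continuousOn
  let C : NNReal := C₀.toNNReal
  have hC : ∀ x ∈ B, ‖fderiv ℝ u x‖ ≤ C := fun x hx => (hC₀ x hx).trans (Real.le_coe_toNNReal _)
  have huL : LipschitzOnWith C u B :=
    (convex_closedBall (0 : E) 1).lipschitzOnWith_of_nnnorm_fderiv_le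
      (fun x _ => (hu.differentiable one_ne_zero) x) fun x hx => hC x hx
  have hLip := lipschitzWith_indicator_closedBall huL fun x hx => by simp [u, hsphere x hx]
  let v : ℕ → ℝ := fun i => ((C : ℝ) + 1 + i)⁻¹
  have hv0 : ∀ i, 0 ≤ v i := fun i => by positivity
  have hvC : ∀ i, v i * C < 1 := by
    intro i
    have : (0 : ℝ) < (C : ℝ) + 1 + i := by positivity
    rw [inv_mul_lt_iff₀ this]
    linarith [(Nat.cast_nonneg i : (0 : ℝ) ≤ i)]
  have hvinj : Function.Injective v := fun i j hij => by simpa [v] using hij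
  obtain ⟨s, c, hc, hdet⟩ := exists_det_one_add_eq_sum E v hvinj
  have hint : ∀ t : ℝ, 0 ≤ t → t * C < 1 →
      ∫ x in B, (1 + t • fderiv ℝ u x).det ∂μ = μ.real B := by
    intro t ht htC
    let f : E → E := fun x => x + t • B.indicator u x
    have hf : Function.Bijective f := bijective_add_smul_of_lipschitzWith hLip ht htC
    have hout : ∀ x, x ∉ B → f x = x := fun x hx => by simp [f, hx]
    have himg : f '' B = B := by
      have h1 : f '' Bᶜ = Bᶜ := by
        conv_rhs => rw [← Set.image_id Bᶜ]
        exact Set.image_congr fun x hx => hout x hx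
      rw [Set.image_compl_eq hf] at h1
      exact compl_injective h1
    have hderiv : ∀ x ∈ B, HasFDerivWithinAt f (1 + t • fderiv ℝ u x) B x := by
      intro x hx
      have h1 : HasFDerivAt (fun y => y + t • u y) (1 + t • fderiv ℝ u x) x :=
        (hasFDerivAt_id x).add (((hu.differentiable one_ne_zero) x).hasFDerivAt.const_smul t)
      exact h1.hasFDerivWithinAt.congr (fun y hy => by simp [f, hy]) (by simp [f, hx])
    have h1 := MeasureTheory.integral_image_eq_integral_abs_det_fderiv_smul μ
      hBc.measurableSet hderiv hf.injective.injOn (fun _ => (1 : ℝ))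
    rw [himg] at h1
    simp only [smul_eq_mul, mul_one, MeasureTheory.setIntegral_const] at h1
    rw [h1]
    refine MeasureTheory.setIntegral_congr_fun hBc.measurableSet fun x hx => ?_
    refine (abs_of_pos (det_one_add_smul_pos _ ht ?_)).symm
    exact (mul_le_mul_of_nonneg_left (hC x hx) ht).trans_lt htC
  have hone : ∫ x in B, (1 + fderiv ℝ u x).det ∂μ = μ.real B := by
    rw [show (fun x => (1 + fderiv ℝ u x).det) = _ from funext fun x => hdet (fderiv ℝ u x),
      MeasureTheory.integral_finsetSum]
    · simp only [MeasureTheory.integral_const_mul, hint _ (hv0 _) (hvC _)]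
      rw [← Finset.sum_mul, hc, one_mul]
    · intro i _
      have hcont : Continuous fun x => (1 + v i • fderiv ℝ u x).det :=
        ContinuousLinearMap.continuous_det.comp (by fun_prop)
      have hI : MeasureTheory.Integrable _ (μ.restrict B) :=
        hcont.continuousOn.integrableOn_compact hBc
      exact hI.const_mul _
  have hzero : ∀ x, (1 + fderiv ℝ u x).det = 0 := by
    intro x
    have hd : HasFDerivAt h (1 + fderiv ℝ u x) x := by
      have h1 := (hasFDerivAt_id x).add ((hu.differentiable one_ne_zero) x).hasFDerivAt
      exact h1.congr_of_eventuallyEq (Filter.Eventually.of_forall fun y => by simp [u])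
    by_contra hne
    have hunit : IsUnit (LinearMap.det ((1 + fderiv ℝ u x : E →L[ℝ] E) : E →ₗ[ℝ] E)) :=
      isUnit_iff_ne_zero.2 hne
    obtain ⟨w, hw⟩ := (LinearEquiv.ofIsUnitDet (v := Module.finBasis ℝ E)
      (v' := Module.finBasis ℝ E)
      (by rwa [LinearMap.det_toMatrix])).surjective (h x)
    have hw' : (1 + fderiv ℝ u x) w = h x := hw
    have h2 : HasFDerivAt (fun y => ‖h y‖ ^ 2) _ x := hd.norm_sq
    have h3 : HasFDerivAt (fun y => ‖h y‖ ^ 2) (0 : E →L[ℝ] ℝ) x := by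
      simp only [hnorm]
      exact hasFDerivAt_const _ _
    have h4 := congrArg (fun L : E →L[ℝ] ℝ => L w) (h2.unique h3)
    generalize (1 + fderiv ℝ u x : E →L[ℝ] E) = D at hw' h4
    simp [hw', hnorm] at h4
  rw [MeasureTheory.setIntegral_congr_fun hBc.measurableSet (fun x _ => hzero x)] at hone
  simp only [MeasureTheory.integral_zero] at hone
  have hpos : 0 < μ.real B :=
    ENNReal.toReal_pos (Metric.measure_closedBall_pos μ 0 one_pos).ne' hBc.measure_lt_top.ne
  exact hpos.ne hone

/-- Brouwer's fixed point theorem for bounded continuous self-maps of a Euclidean space. -/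
theorem exists_fixedPoint_of_norm_le {E : Type*} [NormedAddCommGroup E]
    [InnerProductSpace ℝ E] [FiniteDimensional ℝ E] {T : E → E} (hT : Continuous T) {R : ℝ}
    (hR : ∀ x, ‖T x‖ ≤ R) : ∃ x, T x = x := by
  by_contra! hfix
  have hR0 : 0 ≤ R := (norm_nonneg _).trans (hR 0)
  let φ : E → ℝ := fun x => max 0 (min 1 (R + 1 - ‖x‖))
  let f : E → E := fun x => x - φ x • T x
  have hφ : Continuous φ := by fun_prop
  have hf : Continuous f := by fun_prop
  have hf0 : ∀ x, f x ≠ 0 := by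
    intro x hx
    have hx' : x = φ x • T x := sub_eq_zero.1 hx
    have hφ0 : 0 ≤ φ x := le_max_left _ _
    have hφ1 : φ x ≤ 1 := max_le zero_le_one (min_le_left _ _)
    have hxR : ‖x‖ ≤ R := by
      calc ‖x‖ = φ x * ‖T x‖ := by
            conv_lhs => rw [hx', norm_smul, Real.norm_of_nonneg hφ0]
        _ ≤ 1 * R := mul_le_mul hφ1 (hR x) (norm_nonneg _) zero_le_one
        _ = R := one_mul R
    have : φ x = 1 := by
      simp only [φ]
      rw [min_eq_left (by linarith), max_eq_right zero_le_one]
    rw [this, one_smul] at hx'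
    exact hfix x hx'.symm
  have hfU : ∀ x : E, R + 1 ≤ ‖x‖ → f x = x := by
    intro x hx
    have : φ x = 0 := max_eq_left ((min_le_right _ _).trans (by linarith))
    simp [f, this]
  obtain ⟨g, hg, hgf, hgS, -⟩ := hf.exists_contDiff_approx_and_eqOn 1 hf.norm
    (fun x => norm_pos_iff.2 (hf0 x))
    (S := {x | R + 2 ≤ ‖x‖}) (U := {x | R + 1 < ‖x‖})
    (isClosed_le continuous_const continuous_norm)
    ((isOpen_lt continuous_const continuous_norm).mem_nhdsSet.2 fun x hx => by
      have : R + 2 ≤ ‖x‖ := hx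
      show R + 1 < ‖x‖
      linarith)
    (contDiffOn_id.congr fun x hx => hfU x (le_of_lt hx))
  have hg0 : ∀ x, g x ≠ 0 := by
    intro x hx
    have := hgf x
    rw [hx, dist_zero_left] at this
    exact lt_irrefl _ this
  have hρ : 0 < R + 2 := by linarith
  have hg' : ContDiff ℝ 1 fun x => g ((R + 2) • x) := by
    have : ContDiff ℝ 1 g := by exact_mod_cast hg
    exact this.comp (contDiff_const.smul contDiff_id)
  refine not_exists_contDiff_retraction_sphere
    (h := fun x => ‖g ((R + 2) • x)‖⁻¹ • g ((R + 2) • x)) ?_ ?_ ?_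
  · exact ((hg'.norm ℝ fun x => hg0 _).inv fun x => norm_ne_zero_iff.2 (hg0 _)).smul hg'
  · intro x
    rw [norm_smul, norm_inv, norm_norm, inv_mul_cancel₀ (norm_ne_zero_iff.2 (hg0 _))]
  · intro x hx
    have hn : ‖(R + 2) • x‖ = R + 2 := by rw [norm_smul, hx, mul_one, Real.norm_of_nonneg hρ.le]
    have h1 : g ((R + 2) • x) = (R + 2) • x :=
      (hgS (show R + 2 ≤ ‖(R + 2) • x‖ from hn.ge)).trans (hfU _ (by rw [hn]; linarith))
    simp only [h1, hn]
    rw [smul_smul, inv_mul_cancel₀ hρ.ne', one_smul]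

/-- Brouwer's fixed point theorem for continuous self-maps of `ι → ℝ` with range in a box. -/
theorem exists_fixedPoint_of_abs_le {ι : Type*} [Fintype ι] {T : (ι → ℝ) → ι → ℝ}
    (hT : Continuous T) {b : ι → ℝ} (hb : ∀ x i, |T x i| ≤ b i) : ∃ x, T x = x := by
  let e := EuclideanSpace.equiv ι ℝ
  obtain ⟨R, hR⟩ := ((isCompact_Icc (a := -b) (b := b)).image
    e.symm.continuous).isBounded.exists_norm_le
  obtain ⟨x, hx⟩ := exists_fixedPoint_of_norm_le (T := fun x => e.symm (T (e x)))
    (e.symm.continuous.comp (hT.comp e.continuous)) (R := R) fun x => hR _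
      ⟨_, ⟨fun i => (abs_le.1 (hb _ i)).1, fun i => (abs_le.1 (hb _ i)).2⟩, rfl⟩
  exact ⟨e x, by simpa using congrArg e hx⟩

/-- The antisymmetrization under `Fin.rev` of the running maximum of `x`. -/
noncomputable def oddRunningMax {n : ℕ} (x : Fin n → ℝ) (j : Fin n) : ℝ :=
  ((Finset.Iic j).sup' Finset.nonempty_Iic x - (Finset.Iic j.rev).sup' Finset.nonempty_Iic x) / 2

theorem oddRunningMax_rev {n : ℕ} (x : Fin n → ℝ) (j : Fin n) :
    oddRunningMax x j.rev = -oddRunningMax x j := by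
  simp only [oddRunningMax, Fin.rev_rev]
  ring

theorem continuous_oddRunningMax {n : ℕ} (j : Fin n) :
    Continuous fun x : Fin n → ℝ => oddRunningMax x j := by
  unfold oddRunningMax
  exact ((Continuous.finset_sup'_apply _ fun i _ => continuous_apply i).sub
    (Continuous.finset_sup'_apply _ fun i _ => continuous_apply i)).div_const 2

theorem oddRunningMax_eq_of_monotone {n : ℕ} {x : Fin n → ℝ} (hodd : ∀ j, x j.rev = -x j)
    (hx : Monotone x) : oddRunningMax x = x := by
  have h : ∀ j, (Finset.Iic j).sup' Finset.nonempty_Iic x = x j := fun j =>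
    le_antisymm (Finset.sup'_le _ _ fun i hi => hx (Finset.mem_Iic.1 hi))
      (Finset.le_sup' x (Finset.mem_Iic.2 le_rfl))
  funext j
  simp only [oddRunningMax, h, hodd]
  ring

theorem monotone_of_oddRunningMax {n : ℕ} {x : Fin n → ℝ} (hodd : ∀ j, x j.rev = -x j)
    (h : ∀ i j, i < j → oddRunningMax x i = oddRunningMax x j → x i ≤ x j) : Monotone x := by
  cases n with
  | zero => exact fun i => i.elim0
  | succ n =>
    have key : ∀ i : Fin n, x i.succ < x i.castSucc →
        (Finset.Iic i.succ).sup' Finset.nonempty_Iic x =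
          (Finset.Iic i.castSucc).sup' Finset.nonempty_Iic x := by
      intro i hi
      refine le_antisymm (Finset.sup'_le _ _ fun l hl => ?_)
        (Finset.sup'_mono x (Finset.Iic_subset_Iic.2 i.castSucc_lt_succ.le) Finset.nonempty_Iic)
      rcases (Finset.mem_Iic.1 hl).eq_or_lt with rfl | hlt
      · exact hi.le.trans (Finset.le_sup' x (Finset.mem_Iic.2 le_rfl))
      · exact Finset.le_sup' x (Finset.mem_Iic.2 (Fin.le_castSucc_iff.2 hlt))
    rw [Fin.monotone_iff_le_succ]
    intro i
    by_contra! hi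
    refine hi.not_ge (h _ _ i.castSucc_lt_succ ?_)
    have hrev : x i.rev.succ < x i.rev.castSucc := by
      rw [← Fin.rev_castSucc, ← Fin.rev_succ, hodd, hodd]
      linarith
    simp only [oddRunningMax, Fin.rev_castSucc, Fin.rev_succ, key i hi, key i.rev hrev]

/-- Truncation of a real number to the interval `[-b, b]`. -/
noncomputable def truncate (b v : ℝ) : ℝ := max (-b) (min b v)

theorem continuous_truncate (b : ℝ) : Continuous (truncate b) := by
  unfold truncate
  fun_prop

theorem monotone_truncate (b : ℝ) : Monotone (truncate b) := fun _ _ h =>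
  max_le_max le_rfl (min_le_min le_rfl h)

theorem abs_truncate_le {b : ℝ} (hb : 0 ≤ b) (v : ℝ) : |truncate b v| ≤ b :=
  abs_le.2 ⟨le_max_left _ _, max_le (by linarith) (min_le_left _ _)⟩

theorem truncate_neg {b : ℝ} (hb : 0 ≤ b) (v : ℝ) : truncate b (-v) = -truncate b v := by
  unfold truncate
  rcases le_total b v with h1 | h1 <;> rcases le_total (-b) v with h2 | h2 <;>
    simp only [min_def, max_def] <;> split_ifs <;> linarith

theorem eq_zero_of_truncate_sub_eq {b x e : ℝ} (hb : 0 ≤ b) (h : truncate b (x - e) = x)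
    (hpos : x = b → 0 < e) (hneg : x = -b → e < 0) : e = 0 := by
  unfold truncate at h
  rcases max_choice (-b) (min b (x - e)) with h1 | h1
  · have hx : x = -b := by rw [← h, h1]
    have he := hneg hx
    have h2 : min b (x - e) ≤ -b := by rw [← h1]; exact le_max_right _ _
    rcases min_le_iff.1 h2 with h3 | h3
    · linarith [hpos (by linarith)]
    · linarith
  · rcases min_choice b (x - e) with h2 | h2
    · have hx : x = b := by rw [← h, h1, h2]
      have := hpos hx
      have := min_le_right b (x - e)
      linarith
    · linarith

theorem theta_neg (U x : ℝ) : theta U (-x) = -theta U x := by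
  unfold theta
  rw [mul_neg, neg_div, arctan_neg]
  ring

theorem continuous_theta (U : ℝ) : Continuous (theta U) := by
  unfold theta
  exact continuous_const.mul (continuous_arctan.comp (by fun_prop))

theorem antitone_theta {U : ℝ} (hU : 0 < U) : Antitone (theta U) := by
  intro x y hxy
  unfold theta
  have : arctan (2 * x / U) ≤ arctan (2 * y / U) := arctan_strictMono.monotone (by gcongr)
  linarith

theorem abs_theta_le (U x : ℝ) : |theta U x| ≤ π := by
  unfold theta
  have h1 := arctan_lt_pi_div_two (2 * x / U)
  have h2 := neg_pi_div_two_lt_arctan (2 * x / U)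
  exact abs_le.2 ⟨by linarith, by linarith⟩

theorem sum_theta_eq_zero {n : ℕ} (U : ℝ) {lam : Fin n → ℝ} (hodd : ∀ j, lam j.rev = -lam j) :
    ∑ β, theta U (-2 * lam β) = 0 := by
  have h := Equiv.sum_comp Fin.revPerm fun β => theta U (-2 * lam β)
  simp only [Fin.revPerm_apply, hodd, mul_neg, theta_neg, Finset.sum_neg_distrib] at h
  linarith

/-- The defect of the charge Lieb–Wu equation with index `j`. -/
noncomputable def chargeDefect {N M : ℕ} (Na : ℕ) (U : ℝ) (k : Fin N → ℝ) (lam : Fin M → ℝ)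
    (j : Fin N) : ℝ :=
  (Na : ℝ) * k j - 2 * π * (((j : ℕ) : ℝ) + 1 - ((N : ℝ) + 1) / 2)
    - ∑ β : Fin M, theta U (2 * Real.sin (k j) - 2 * lam β)

/-- The defect of the spin Lieb–Wu equation with index `α`. -/
noncomputable def spinDefect {N M : ℕ} (U : ℝ) (k : Fin N → ℝ) (lam : Fin M → ℝ)
    (α : Fin M) : ℝ :=
  ∑ j : Fin N, theta U (2 * Real.sin (k j) - 2 * lam α)
    - 2 * π * (((α : ℕ) : ℝ) + 1 - ((M : ℝ) + 1) / 2) + ∑ β : Fin M, theta U (lam α - lam β)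

theorem Fin.quantumNumber_rev {n : ℕ} (j : Fin n) :
    ((j.rev : ℕ) : ℝ) + 1 - ((n : ℝ) + 1) / 2 = -(((j : ℕ) : ℝ) + 1 - ((n : ℝ) + 1) / 2) := by
  rw [Fin.val_rev, Nat.cast_sub (by omega)]
  push_cast
  ring

theorem Fin.abs_quantumNumber_le {n : ℕ} (j : Fin n) :
    |((j : ℕ) : ℝ) + 1 - ((n : ℝ) + 1) / 2| ≤ ((n : ℝ) - 1) / 2 := by
  have h1 : ((j : ℕ) : ℝ) + 1 ≤ n := by exact_mod_cast j.2
  have h2 : (0 : ℝ) ≤ ((j : ℕ) : ℝ) := Nat.cast_nonneg _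
  exact abs_le.2 ⟨by linarith, by linarith⟩

theorem sum_theta_odd {n : ℕ} (U s : ℝ) {lam : Fin n → ℝ} (c : ℝ)
    (hodd : ∀ j, lam j.rev = -lam j) :
    ∑ β, theta U (-s - c * lam β) = -∑ β, theta U (s - c * lam β) := by
  rw [← Finset.sum_neg_distrib, ← Equiv.sum_comp Fin.revPerm]
  refine Finset.sum_congr rfl fun β _ => ?_
  rw [Fin.revPerm_apply, hodd, ← theta_neg]
  congr 1
  ring

theorem chargeDefect_rev {N M : ℕ} (Na : ℕ) (U : ℝ) {k : Fin N → ℝ} {lam : Fin M → ℝ}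
    (hk : ∀ j, k j.rev = -k j) (hlam : ∀ α, lam α.rev = -lam α) (j : Fin N) :
    chargeDefect Na U k lam j.rev = -chargeDefect Na U k lam j := by
  unfold chargeDefect
  rw [Fin.quantumNumber_rev, hk, Real.sin_neg, mul_neg 2 (Real.sin _), sum_theta_odd U _ 2 hlam]
  ring

theorem spinDefect_rev {N M : ℕ} (U : ℝ) {k : Fin N → ℝ} {lam : Fin M → ℝ}
    (hk : ∀ j, k j.rev = -k j) (hlam : ∀ α, lam α.rev = -lam α) (α : Fin M) :
    spinDefect U k lam α.rev = -spinDefect U k lam α := by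
  have h1 := sum_theta_odd U (lam α) 1 hlam
  simp only [one_mul] at h1
  have h2 : ∑ j : Fin N, theta U (2 * Real.sin (k j) - 2 * -lam α)
      = -∑ j : Fin N, theta U (2 * Real.sin (k j) - 2 * lam α) := by
    rw [← Finset.sum_neg_distrib, ← Equiv.sum_comp Fin.revPerm]
    refine Finset.sum_congr rfl fun j _ => ?_
    rw [Fin.revPerm_apply, hk, Real.sin_neg, ← theta_neg]
    congr 1
    ring
  unfold spinDefect
  rw [Fin.quantumNumber_rev, hlam, h1, h2]
  ring

theorem chargeDefect_lt_of_eq {N M : ℕ} (Na : ℕ) (U : ℝ) {k : Fin N → ℝ} (lam : Fin M → ℝ)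
    {i j : Fin N} (hij : i < j) (h : k i = k j) :
    chargeDefect Na U k lam j < chargeDefect Na U k lam i := by
  have h1 : ((i : ℕ) : ℝ) < (j : ℕ) := by exact_mod_cast hij
  unfold chargeDefect
  rw [h]
  nlinarith [Real.pi_pos]

theorem spinDefect_lt_of_eq {N M : ℕ} (U : ℝ) (k : Fin N → ℝ) {lam : Fin M → ℝ}
    {i j : Fin M} (hij : i < j) (h : lam i = lam j) :
    spinDefect U k lam j < spinDefect U k lam i := by
  have h1 : ((i : ℕ) : ℝ) < (j : ℕ) := by exact_mod_cast hij
  unfold spinDefect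
  rw [h]
  nlinarith [Real.pi_pos]

theorem chargeDefect_pos_of_eq_pi {N M Na : ℕ} (hNa : N ≤ Na) (U : ℝ) {k : Fin N → ℝ}
    {lam : Fin M → ℝ} (hlam : ∀ α, lam α.rev = -lam α) {j : Fin N} (hj : k j = π) :
    0 < chargeDefect Na U k lam j := by
  have h1 := (abs_le.1 (Fin.abs_quantumNumber_le j)).2
  have h2 : (N : ℝ) ≤ Na := by exact_mod_cast hNa
  have h3 : ∑ β : Fin M, theta U (2 * Real.sin (k j) - 2 * lam β) = 0 := by
    rw [← sum_theta_eq_zero U hlam]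
    refine Finset.sum_congr rfl fun β _ => ?_
    rw [hj, Real.sin_pi]
    congr 1
    ring
  unfold chargeDefect
  rw [h3, hj]
  nlinarith [Real.pi_pos]

/-- For large `L` the spin defect at `lam α = L` is positive, uniformly in the other unknowns. -/
theorem exists_spinDefect_pos {N M : ℕ} (hMN : 2 * M ≤ N) {U : ℝ} (hU : 0 < U) :
    ∃ L : ℝ, 0 ≤ L ∧ ∀ (k : Fin N → ℝ) (lam : Fin M → ℝ) (α : Fin M), lam α = L →
      0 < spinDefect U k lam α := by
  rcases Nat.eq_zero_or_pos M with rfl | hM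
  · exact ⟨0, le_rfl, fun _ _ α => α.elim0⟩
  have hM' : (0 : ℝ) < M := by exact_mod_cast hM
  have hMN' : 2 * (M : ℝ) ≤ N := by exact_mod_cast hMN
  have htend : Filter.Tendsto (fun L : ℝ => arctan (4 * (L - 1) / U)) Filter.atTop
      (nhds (π / 2)) := by
    refine (tendsto_nhds_of_tendsto_nhdsWithin tendsto_arctan_atTop).comp ?_
    refine Filter.Tendsto.atTop_div_const hU (Filter.Tendsto.const_mul_atTop (by norm_num) ?_)
    exact Filter.tendsto_atTop_add_const_right _ _ Filter.tendsto_id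
  have hlt : π / 2 * ((M - 1) / M) < π / 2 := by
    have : ((M : ℝ) - 1) / M < 1 := by rw [div_lt_one hM']; linarith
    nlinarith [Real.pi_pos]
  obtain ⟨L, hL, hL1⟩ :=
    ((htend.eventually (lt_mem_nhds hlt)).and (Filter.eventually_ge_atTop 1)).exists
  refine ⟨L, by linarith, fun k lam α hα => ?_⟩
  set τ := arctan (4 * (L - 1) / U) with hτ
  have hτ0 : 0 ≤ τ := by
    rw [hτ, ← arctan_zero]
    refine arctan_strictMono.monotone (div_nonneg ?_ hU.le)
    linarith
  have h1 : (N : ℝ) * (2 * τ) ≤ ∑ j : Fin N, theta U (2 * Real.sin (k j) - 2 * lam α) := by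
    have : ∀ j ∈ (Finset.univ : Finset (Fin N)),
        2 * τ ≤ theta U (2 * Real.sin (k j) - 2 * lam α) := by
      intro j _
      have h2 : theta U (2 - 2 * L) = 2 * τ := by
        rw [← neg_neg (2 - 2 * L), theta_neg, theta, hτ,
          show 2 * -(2 - 2 * L) / U = 4 * (L - 1) / U by ring]
        ring
      rw [← h2, hα]
      exact antitone_theta hU (by linarith [Real.sin_le_one (k j)])
    simpa using Finset.card_nsmul_le_sum _ _ _ this
  have h2 : -π * (M - 1) ≤ ∑ β : Fin M, theta U (lam α - lam β) := by
    rw [← Finset.add_sum_erase _ _ (Finset.mem_univ α)]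
    have h3 := Finset.card_nsmul_le_sum (Finset.univ.erase α)
      (fun β => theta U (lam α - lam β)) (-π) fun β _ => (abs_le.1 (abs_theta_le U _)).1
    rw [Finset.card_erase_of_mem (Finset.mem_univ α), Finset.card_univ, Fintype.card_fin,
      nsmul_eq_mul, Nat.cast_sub hM, Nat.cast_one] at h3
    have h4 : theta U (lam α - lam α) = 0 := by simp [theta]
    linarith
  have h3 := (abs_le.1 (Fin.abs_quantumNumber_le α)).2
  have h4 : π * (M - 1) < 2 * M * τ := by
    have : π / 2 * ((M - 1) / M) * (2 * M) = π * (M - 1) := by field_simp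
    nlinarith
  unfold spinDefect
  nlinarith [Real.pi_pos]

theorem odd_of_truncate_sub_eq {n : ℕ} {b : ℝ} (hb : 0 ≤ b) {x e : Fin n → ℝ}
    (he : ∀ j, e j.rev = -e j)
    (hx : ∀ j, truncate b (oddRunningMax x j - e j) = x j) (j : Fin n) : x j.rev = -x j := by
  rw [← hx, ← hx j, ← truncate_neg hb, oddRunningMax_rev, he]
  congr 1
  ring

theorem monotone_of_truncate_sub_eq {n : ℕ} {b : ℝ} (hb : 0 ≤ b) {x e : Fin n → ℝ}
    (he : ∀ j, e j.rev = -e j)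
    (hlt : ∀ i j, i < j → oddRunningMax x i = oddRunningMax x j → e j < e i)
    (hx : ∀ j, truncate b (oddRunningMax x j - e j) = x j) : Monotone x := by
  refine monotone_of_oddRunningMax (odd_of_truncate_sub_eq hb he hx) fun i j hij h => ?_
  rw [← hx i, ← hx j]
  refine monotone_truncate b ?_
  linarith [hlt i j hij h]

theorem continuous_chargeDefect_oddRunningMax {N M : ℕ} (Na : ℕ) (U : ℝ) (j : Fin N) :
    Continuous fun z : Fin N ⊕ Fin M → ℝ => chargeDefect Na U
      (oddRunningMax fun i => z (Sum.inl i)) (oddRunningMax fun β => z (Sum.inr β)) j := by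
  have hk : ∀ i : Fin N, Continuous fun z : Fin N ⊕ Fin M → ℝ =>
      oddRunningMax (fun i => z (Sum.inl i)) i := fun i =>
    (continuous_oddRunningMax i).comp (by fun_prop)
  have hlam : ∀ β : Fin M, Continuous fun z : Fin N ⊕ Fin M → ℝ =>
      oddRunningMax (fun β => z (Sum.inr β)) β := fun β =>
    (continuous_oddRunningMax β).comp (by fun_prop)
  have hθ := continuous_theta U
  unfold chargeDefect
  fun_prop

theorem continuous_spinDefect_oddRunningMax {N M : ℕ} (U : ℝ) (α : Fin M) :
    Continuous fun z : Fin N ⊕ Fin M → ℝ => spinDefect U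
      (oddRunningMax fun i => z (Sum.inl i)) (oddRunningMax fun β => z (Sum.inr β)) α := by
  have hk : ∀ i : Fin N, Continuous fun z : Fin N ⊕ Fin M → ℝ =>
      oddRunningMax (fun i => z (Sum.inl i)) i := fun i =>
    (continuous_oddRunningMax i).comp (by fun_prop)
  have hlam : ∀ β : Fin M, Continuous fun z : Fin N ⊕ Fin M → ℝ =>
      oddRunningMax (fun β => z (Sum.inr β)) β := fun β =>
    (continuous_oddRunningMax β).comp (by fun_prop)
  have hθ := continuous_theta U
  unfold spinDefect
  fun_prop

/-- There are odd monotone `k`, `lam` at which all Lieb–Wu defects vanish. -/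
theorem exists_defects_eq_zero {N M Na : ℕ} (hMN : 2 * M ≤ N) (hNa : N ≤ Na) {U : ℝ}
    (hU : 0 < U) :
    ∃ (k : Fin N → ℝ) (lam : Fin M → ℝ), Monotone k ∧ Monotone lam ∧ (∀ j, |k j| ≤ π) ∧
      (∀ j, k j.rev = -k j) ∧ (∀ α, lam α.rev = -lam α) ∧
      (∀ j, chargeDefect Na U k lam j = 0) ∧ ∀ α, spinDefect U k lam α = 0 := by
  obtain ⟨L, hL0, hL⟩ := exists_spinDefect_pos hMN hU
  let T : (Fin N ⊕ Fin M → ℝ) → Fin N ⊕ Fin M → ℝ := fun z =>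
    let a := oddRunningMax fun i => z (Sum.inl i)
    let b := oddRunningMax fun β => z (Sum.inr β)
    Sum.elim (fun j => truncate π (a j - chargeDefect Na U a b j))
      (fun α => truncate L (b α - spinDefect U a b α))
  have hT : Continuous T := by
    refine continuous_pi fun i => ?_
    rcases i with j | α
    · exact (continuous_truncate π).comp
        (((continuous_oddRunningMax j).comp (by fun_prop)).sub
          (continuous_chargeDefect_oddRunningMax Na U j))
    · exact (continuous_truncate L).comp
        (((continuous_oddRunningMax α).comp (by fun_prop)).sub
          (continuous_spinDefect_oddRunningMax U α))
  obtain ⟨z, hz⟩ := exists_fixedPoint_of_abs_le hT (b := Sum.elim (fun _ => π) fun _ => L) (by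
    rintro x (j | α)
    · exact abs_truncate_le Real.pi_pos.le _
    · exact abs_truncate_le hL0 _)
  set k : Fin N → ℝ := fun i => z (Sum.inl i)
  set lam : Fin M → ℝ := fun β => z (Sum.inr β)
  have hzk : ∀ j, truncate π (oddRunningMax k j
      - chargeDefect Na U (oddRunningMax k) (oddRunningMax lam) j) = k j :=
    fun j => congrFun hz (Sum.inl j)
  have hzl : ∀ α, truncate L (oddRunningMax lam α
      - spinDefect U (oddRunningMax k) (oddRunningMax lam) α) = lam α :=
    fun α => congrFun hz (Sum.inr α)
  have hck := chargeDefect_rev Na U (oddRunningMax_rev k) (oddRunningMax_rev lam)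
  have hsl := spinDefect_rev U (oddRunningMax_rev k) (oddRunningMax_rev lam)
  have hkodd := odd_of_truncate_sub_eq Real.pi_pos.le hck hzk
  have hlodd := odd_of_truncate_sub_eq hL0 hsl hzl
  have hkmono := monotone_of_truncate_sub_eq Real.pi_pos.le hck
    (fun i j hij h => chargeDefect_lt_of_eq Na U _ hij h) hzk
  have hlmono := monotone_of_truncate_sub_eq hL0 hsl
    (fun i j hij h => spinDefect_lt_of_eq U _ hij h) hzl
  rw [oddRunningMax_eq_of_monotone hkodd hkmono, oddRunningMax_eq_of_monotone hlodd hlmono]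
    at hzk hzl hck hsl
  refine ⟨k, lam, hkmono, hlmono, fun j => ?_, hkodd, hlodd, fun j => ?_, fun α => ?_⟩
  · rw [← hzk]
    exact abs_truncate_le Real.pi_pos.le _
  · refine eq_zero_of_truncate_sub_eq Real.pi_pos.le (hzk j)
      (chargeDefect_pos_of_eq_pi hNa U hlodd) fun hj => ?_
    have := chargeDefect_pos_of_eq_pi hNa U (k := k) hlodd (j := j.rev) (by rw [hkodd, hj, neg_neg])
    rw [hck] at this
    linarith
  · refine eq_zero_of_truncate_sub_eq hL0 (hzl α) (hL k lam α) fun hα => ?_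
    have := hL k lam α.rev (by rw [hlodd, hα, neg_neg])
    rw [hsl] at this
    linarith

/-- Existence of a real, ordered, *symmetric* solution of the Lieb–Wu equations:
besides the ordering `-π ≤ k_1 < ⋯ < k_N ≤ π`, `Λ_1 < ⋯ < Λ_M`, the solution
satisfies `k_j = -k_{N+1-j}` and `Λ_α = -Λ_{M+1-α}` (with zero-based indices this
is `k j = -k j.rev`, `Λ α = -Λ α.rev`); in particular the middle `Λ` vanishes. -/
theorem liebWu_exists_symmetric_solution
    (N M Na : ℕ) (hNpos : 0 < N) (hNeven : N % 2 = 0) (hModd : M % 2 = 1)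
    (hMN : 2 * M ≤ N) (hNa : N ≤ Na) (U : ℝ) (hU : 0 < U) :
    ∃ (k : Fin N → ℝ) (Λ : Fin M → ℝ),
      StrictMono k ∧ StrictMono Λ ∧
      (∀ j : Fin N, k j ∈ Set.Icc (-π) π) ∧
      (∀ j : Fin N, (Na : ℝ) * k j =
          2 * π * (((j : ℕ) : ℝ) + 1 - ((N : ℝ) + 1) / 2)
            + ∑ β : Fin M, theta U (2 * Real.sin (k j) - 2 * Λ β)) ∧
      (∀ α : Fin M, ∑ j : Fin N, theta U (2 * Real.sin (k j) - 2 * Λ α) =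
          2 * π * (((α : ℕ) : ℝ) + 1 - ((M : ℝ) + 1) / 2)
            - ∑ β : Fin M, theta U (Λ α - Λ β)) ∧
      (∀ j : Fin N, k j = - k j.rev) ∧
      (∀ α : Fin M, Λ α = - Λ α.rev) ∧
      Λ ⟨(M - 1) / 2, by omega⟩ = 0 := by
  obtain ⟨k, lam, hkm, hlm, hkb, hkodd, hlodd, hk, hl⟩ := exists_defects_eq_zero hMN hNa hU
  refine ⟨k, lam, fun i j hij => (hkm hij.le).lt_of_ne fun h => ?_,
    fun i j hij => (hlm hij.le).lt_of_ne fun h => ?_, fun j => abs_le.1 (hkb j), fun j => ?_,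
    fun α => ?_, fun j => ?_, fun α => ?_, ?_⟩
  · have := chargeDefect_lt_of_eq Na U lam hij h
    rw [hk, hk] at this
    exact lt_irrefl _ this
  · have := spinDefect_lt_of_eq U k hij h
    rw [hl, hl] at this
    exact lt_irrefl _ this
  · have := hk j
    unfold chargeDefect at this
    linarith
  · have := hl α
    unfold spinDefect at this
    linarith
  · rw [hkodd, neg_neg]
  · rw [hlodd, neg_neg]
  · have h1 := hlodd ⟨(M - 1) / 2, by omega⟩
    have h2 : (⟨(M - 1) / 2, by omega⟩ : Fin M).rev = ⟨(M - 1) / 2, by omega⟩ := by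
      ext
      rw [Fin.val_rev]
      dsimp only
      omega
    rw [h2] at h1
    linarith
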